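/- For every positive integer n, there exists a Gaussian normal basis of F_{2^n} over F_2 (i.e., some Gauss period of type (n,k) generates a normal basis) if and only if 8 does not divide n. -/

import Mathlib

section EulerProduct

open IsDedekindDomain ENNReal Filter Topology NumberField

section DedekindDomain

variable {R : Type*} [CommRing R] [IsDedekindDomain R]

/-- Nonzero ideals all of whose prime factors lie in `S`. -/
def factoredIdeals (S : Finset (HeightOneSpectrum R)) : Set (Ideal R) :=
  {I | I ≠ ⊥ ∧ ∀ P : HeightOneSpectrum R, P.asIdeal ∣ I → P ∈ S}

theorem factoredIdeals_empty : factoredIdeals (∅ : Finset (HeightOneSpectrum R)) = {1} := by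
  ext I
  simp only [factoredIdeals, Set.mem_ofPred_eq, Finset.notMem_empty, imp_false,
    Set.mem_singleton_iff]
  constructor
  · rintro ⟨h0, h⟩
    by_contra hI
    obtain ⟨M, hM, hIM⟩ := Ideal.exists_le_maximal I (by simpa using hI)
    exact h ⟨M, hM.isPrime, fun h => h0 (by simpa [h] using hIM)⟩ (Ideal.dvd_iff_le.mpr hIM)
  · rintro rfl
    refine ⟨by simp, fun P hP => ?_⟩
    have := P.isPrime.ne_top
    exact this (by simpa using Ideal.dvd_iff_le.mp hP)

open scoped Classical in
theorem bijective_pow_mul_factoredIdeals {S : Finset (HeightOneSpectrum R)}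
    {P : HeightOneSpectrum R} (hP : P ∉ S) :
    Set.BijOn (fun x : ℕ × Ideal R => P.asIdeal ^ x.1 * x.2)
      (Set.univ ×ˢ factoredIdeals S) (factoredIdeals (insert P S)) := by
  have hPr (Q : HeightOneSpectrum R) : Prime Q.asIdeal :=
    Ideal.prime_of_isPrime Q.ne_bot Q.isPrime
  have hdvd {I : Ideal R} (hI : I ∈ factoredIdeals S) : ¬ P.asIdeal ∣ I := fun h => hP (hI.2 P h)
  refine ⟨?_, ?_, ?_⟩
  · rintro ⟨k, I⟩ ⟨-, hI⟩
    refine ⟨mul_ne_zero (pow_ne_zero _ P.ne_bot) hI.1, fun Q hQ => ?_⟩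
    rcases (hPr Q).dvd_or_dvd hQ with h | h
    · have := (hPr Q).dvd_of_dvd_pow h
      have h2 := Ideal.dvd_iff_le.mp this
      have h3 : P = Q := by
        ext1
        exact (P.isMaximal.eq_of_le Q.isPrime.ne_top h2)
      simp [h3]
    · exact Finset.mem_insert_of_mem (hI.2 Q h)
  · rintro ⟨k, I⟩ ⟨-, hI⟩ ⟨l, J⟩ ⟨-, hJ⟩ h
    have h' : P.asIdeal ^ k * I = P.asIdeal ^ l * J := h
    have e1 : emultiplicity P.asIdeal (P.asIdeal ^ k * I) = k := by
      rw [emultiplicity_mul (hPr P), emultiplicity_eq_zero.mpr (hdvd hI),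
        emultiplicity_pow_self P.ne_bot (hPr P).not_isUnit, add_zero]
    have e2 : emultiplicity P.asIdeal (P.asIdeal ^ l * J) = l := by
      rw [emultiplicity_mul (hPr P), emultiplicity_eq_zero.mpr (hdvd hJ),
        emultiplicity_pow_self P.ne_bot (hPr P).not_isUnit, add_zero]
    rw [h', e2] at e1
    have e3 : l = k := by exact_mod_cast e1
    subst e3
    rw [mul_right_inj' (pow_ne_zero _ P.ne_bot)] at h'
    simp [h']
  · intro I hI
    obtain ⟨J, hIJ, hJ⟩ :=
      (FiniteMultiplicity.of_prime_left (hPr P) hI.1).exists_eq_pow_mul_and_not_dvd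
    refine ⟨(_, J), ⟨trivial, right_ne_zero_of_mul (hIJ ▸ hI.1), fun Q hQ => ?_⟩, hIJ.symm⟩
    have := hI.2 Q (hIJ ▸ hQ.mul_left _)
    rcases Finset.mem_insert.mp this with rfl | h
    · exact (hJ hQ).elim
    · exact h

theorem tsum_factoredIdeals (w : Ideal R →* ℝ≥0∞) (S : Finset (HeightOneSpectrum R)) :
    ∑' I : factoredIdeals S, w I = ∏ P ∈ S, (1 - w P.asIdeal)⁻¹ := by
  classical
  induction S using Finset.induction_on with
  | empty =>
    rw [factoredIdeals_empty, tsum_singleton (1 : Ideal R) w, map_one, Finset.prod_empty]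
  | insert P S hP ih =>
    have hb := bijective_pow_mul_factoredIdeals hP
    rw [Finset.prod_insert hP, ← ih, ← ENNReal.tsum_geometric, ← ENNReal.tsum_mul_right]
    simp_rw [← ENNReal.tsum_mul_left]
    rw [← ENNReal.tsum_prod]
    rw [← hb.image_eq, tsum_image _ hb.injOn]
    rw [← (((Equiv.Set.univ ℕ).symm.prodCongr (Equiv.refl (factoredIdeals S))).trans
      (Equiv.Set.prod _ _).symm).tsum_eq]
    simp [Equiv.Set.prod]
    rfl

theorem iSup_prod_eq_tsum_ideal (w : Ideal R →* ℝ≥0∞) (h0 : w ⊥ = 0) :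
    ⨆ S : Finset (HeightOneSpectrum R), ∏ P ∈ S, (1 - w P.asIdeal)⁻¹ = ∑' I : Ideal R, w I := by
  classical
  simp_rw [← tsum_factoredIdeals]
  refine le_antisymm (iSup_le fun S => ENNReal.tsum_comp_le_tsum_of_injective
    Subtype.val_injective _) ?_
  rw [ENNReal.tsum_eq_iSup_sum]
  refine iSup_le fun T => ?_
  have hfin (I : Ideal R) (hI : I ≠ ⊥) : {P : HeightOneSpectrum R | P.asIdeal ∣ I}.Finite :=
    Ideal.finite_factors hI
  let S : Finset (HeightOneSpectrum R) :=
    T.biUnion fun I => if h : I = ⊥ then ∅ else (hfin I h).toFinset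
  refine le_iSup_of_le S ?_
  rw [← Finset.sum_filter_add_sum_filter_not T (fun I => I ≠ ⊥)]
  have : ∑ I ∈ T with ¬ I ≠ ⊥, w I = 0 := Finset.sum_eq_zero fun I hI => by
    simp only [not_not, Finset.mem_filter] at hI
    rw [hI.2, h0]
  rw [this, add_zero, tsum_subtype (factoredIdeals S) w]
  refine le_trans (Finset.sum_le_sum fun I hI => ?_) (ENNReal.sum_le_tsum (T.filter (· ≠ ⊥)))
  rw [Set.indicator_of_mem]
  simp only [Finset.mem_filter] at hI
  refine ⟨hI.2, fun P hP => Finset.mem_biUnion.mpr ⟨I, hI.1, ?_⟩⟩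
  simp [hI.2, hP]

end DedekindDomain

variable (K : Type*) [Field K] [NumberField K]

/-- The multiplicative weight `I ↦ N(I)⁻ˢ` on ideals. -/
noncomputable def absNormRpow (s : ℝ) : Ideal (𝓞 K) →* ℝ≥0∞ where
  toFun I := ENNReal.ofReal ((Ideal.absNorm I : ℝ) ^ (-s))
  map_one' := by simp
  map_mul' I J := by
    rw [map_mul, Nat.cast_mul, Real.mul_rpow (by positivity) (by positivity),
      ENNReal.ofReal_mul (by positivity)]

theorem tsum_absNormRpow {s : ℝ} (hs : 1 < s) (h : dedekindZeta K s ≠ 0) :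
    ∑' I, absNormRpow K s I = ENNReal.ofReal (dedekindZeta K s).re := by
  set a : ℕ → ℕ := fun n => Nat.card {I : Ideal (𝓞 K) // Ideal.absNorm I = n} with ha
  have hterm (n : ℕ) : LSeries.term (fun n => (a n : ℂ)) s n =
      ((a n * (n : ℝ) ^ (-s) : ℝ) : ℂ) := by
    rcases eq_or_ne n 0 with rfl | hn
    · simp [Real.zero_rpow (by linarith : -s ≠ 0)]
    · rw [LSeries.term_of_ne_zero hn, Real.rpow_neg (by positivity)]
      push_cast
      rw [Complex.ofReal_cpow (by positivity)]
      simp [div_eq_mul_inv]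
  have hsum : Summable (LSeries.term (fun n => (a n : ℂ)) s) := by
    by_contra hn
    exact h (tsum_eq_zero_of_not_summable hn)
  have hz : dedekindZeta K s = ((∑' n : ℕ, a n * (n : ℝ) ^ (-s) : ℝ) : ℂ) := by
    rw [Complex.ofReal_tsum]
    exact tsum_congr hterm
  have hsumR : Summable (fun n : ℕ => a n * (n : ℝ) ^ (-s)) := by
    rw [← Complex.summable_ofReal]
    exact hsum.congr fun n => (hterm n)
  rw [hz, Complex.ofReal_re, ENNReal.ofReal_tsum_of_nonneg (fun n => by positivity) hsumR,
    ← ENNReal.tsum_fiberwise _ (Ideal.absNorm : Ideal (𝓞 K) → ℕ)]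
  refine tsum_congr fun n => ?_
  have hfin : Finite {I : Ideal (𝓞 K) // Ideal.absNorm I = n} :=
    Ideal.finite_setOfPred_absNorm_eq n
  have : ∀ I : (Ideal.absNorm : Ideal (𝓞 K) → ℕ) ⁻¹' {n},
      absNormRpow K s I = ENNReal.ofReal ((n : ℝ) ^ (-s)) := by
    rintro ⟨I, rfl⟩
    rfl
  rw [tsum_congr this, ENNReal.tsum_const, ENNReal.ofReal_mul (by positivity)]
  congr 1
  rw [ENNReal.ofReal_natCast]
  have e : ENat.card ((Ideal.absNorm : Ideal (𝓞 K) → ℕ) ⁻¹' {n}) = a n := by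
    exact ENat.card_eq_coe_natCard {I : Ideal (𝓞 K) // Ideal.absNorm I = n}
  rw [e]
  simp

theorem inv_one_sub_le_exp {x : ℝ} (h1 : x ≤ 1 / 2) :
    (1 - x)⁻¹ ≤ Real.exp (x + 2 * x ^ 2) := by
  have h2 : 0 < 1 - x := by linarith
  have h3 : (1 - x)⁻¹ = x / (1 - x) + 1 := by field_simp; ring
  have h4 : x / (1 - x) ≤ x + 2 * x ^ 2 := by
    rw [div_le_iff₀ h2]
    nlinarith [mul_nonneg (sq_nonneg x) (by linarith : 0 ≤ 1 - 2 * x)]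
  rw [h3]
  exact (Real.add_one_le_exp _).trans (Real.exp_le_exp.mpr h4)

theorem exp_le_inv_one_sub {x : ℝ} (h1 : x ≤ 1 / 2) :
    Real.exp x ≤ (1 - x)⁻¹ := by
  have h2 : 0 < 1 - x := by linarith
  rw [le_inv_comm₀ (Real.exp_pos _) h2, ← Real.exp_neg]
  exact Real.one_sub_le_exp_neg x

theorem two_le_absNorm (P : HeightOneSpectrum (𝓞 K)) : 2 ≤ Ideal.absNorm P.asIdeal := by
  have h0 : Ideal.absNorm P.asIdeal ≠ 0 := by
    rw [Ne, Ideal.absNorm_eq_zero_iff]; exact P.ne_bot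
  have h1 : Ideal.absNorm P.asIdeal ≠ 1 := by
    rw [Ne, Ideal.absNorm_eq_one_iff]; exact P.isPrime.ne_top
  omega

theorem absNorm_rpow_le_half (P : HeightOneSpectrum (𝓞 K)) {s : ℝ} (hs : 1 ≤ s) :
    (Ideal.absNorm P.asIdeal : ℝ) ^ (-s) ≤ 1 / 2 := by
  have h2 : (2 : ℝ) ≤ Ideal.absNorm P.asIdeal := by exact_mod_cast two_le_absNorm K P
  calc (Ideal.absNorm P.asIdeal : ℝ) ^ (-s) ≤ (Ideal.absNorm P.asIdeal : ℝ) ^ (-1 : ℝ) :=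
        Real.rpow_le_rpow_of_exponent_le (by linarith) (by linarith)
    _ = (Ideal.absNorm P.asIdeal : ℝ)⁻¹ := Real.rpow_neg_one _
    _ ≤ 2⁻¹ := inv_anti₀ (by norm_num) h2
    _ = 1 / 2 := by norm_num

theorem primeSum_bounds {s : ℝ} (hs : 1 < s) (h : 0 < (dedekindZeta K s).re) :
    Summable (fun P : HeightOneSpectrum (𝓞 K) => (Ideal.absNorm P.asIdeal : ℝ) ^ (-s)) ∧
    ∑' P : HeightOneSpectrum (𝓞 K), (Ideal.absNorm P.asIdeal : ℝ) ^ (-s)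
      ≤ Real.log (dedekindZeta K s).re ∧
    Real.log (dedekindZeta K s).re ≤
      ∑' P : HeightOneSpectrum (𝓞 K), (Ideal.absNorm P.asIdeal : ℝ) ^ (-s) +
      2 * ∑' P : HeightOneSpectrum (𝓞 K), ((Ideal.absNorm P.asIdeal : ℝ) ^ (-s)) ^ 2 := by
  set X : HeightOneSpectrum (𝓞 K) → ℝ := fun P => (Ideal.absNorm P.asIdeal : ℝ) ^ (-s) with hX
  set D := (dedekindZeta K s).re
  have hX0 P : 0 ≤ X P := by positivity
  have hX2 P : X P ≤ 1 / 2 := absNorm_rpow_le_half K P hs.le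
  have hsup := iSup_prod_eq_tsum_ideal (absNormRpow K s) (by
    simp [absNormRpow, Real.zero_rpow (by linarith : -s ≠ 0)])
  rw [tsum_absNormRpow K hs (fun h' => by simp [D, h'] at h)] at hsup
  have hprod (S : Finset (HeightOneSpectrum (𝓞 K))) :
      ∏ P ∈ S, (1 - absNormRpow K s P.asIdeal)⁻¹ =
        ENNReal.ofReal (∏ P ∈ S, (1 - X P)⁻¹) := by
    rw [ENNReal.ofReal_prod_of_nonneg fun P _ => inv_nonneg.mpr (by linarith [hX2 P])]
    refine Finset.prod_congr rfl fun P _ => ?_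
    rw [ENNReal.ofReal_inv_of_pos (by linarith [hX2 P]), ENNReal.ofReal_sub _ (hX0 P),
      ENNReal.ofReal_one]
    rfl
  simp_rw [hprod] at hsup
  have hle (S : Finset (HeightOneSpectrum (𝓞 K))) : ∑ P ∈ S, X P ≤ Real.log D := by
    rw [Real.le_log_iff_exp_le h, Real.exp_sum]
    have : ENNReal.ofReal (∏ P ∈ S, (1 - X P)⁻¹) ≤ ENNReal.ofReal D :=
      hsup ▸ le_iSup (fun S => ENNReal.ofReal (∏ P ∈ S, (1 - X P)⁻¹)) S
    exact (Finset.prod_le_prod (fun P _ => (Real.exp_pos _).le)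
      (fun P _ => exp_le_inv_one_sub (hX2 P))).trans ((ENNReal.ofReal_le_ofReal_iff h.le).mp this)
  have hs1 : Summable X := summable_of_sum_le hX0 hle
  have hs2 : Summable fun P => X P ^ 2 :=
    hs1.of_nonneg_of_le (fun P => sq_nonneg _) fun P => by nlinarith [hX0 P, hX2 P]
  refine ⟨hs1, hs1.tsum_le_of_sum_le hle, ?_⟩
  rw [Real.log_le_iff_le_exp h, ← ENNReal.ofReal_le_ofReal_iff (Real.exp_pos _).le, ← hsup]
  refine iSup_le fun S => ENNReal.ofReal_le_ofReal ?_
  refine (Finset.prod_le_prod (fun P _ => inv_nonneg.mpr (by linarith [hX2 P]))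
      (fun P _ => inv_one_sub_le_exp (hX2 P))).trans ?_
  rw [← Real.exp_sum, Finset.sum_add_distrib, ← Finset.mul_sum]
  have a1 := hs1.sum_le_tsum S (fun P _ => hX0 P)
  have a2 := hs2.sum_le_tsum S (fun P _ => sq_nonneg _)
  exact Real.exp_le_exp.mpr (by linarith)

theorem exists_abs_tsum_absNorm_rpow_add_log_le :
    ∃ C : ℝ, ∀ᶠ s : ℝ in 𝓝[>] 1,
      Summable (fun P : HeightOneSpectrum (𝓞 K) => (Ideal.absNorm P.asIdeal : ℝ) ^ (-s)) ∧
      |∑' P : HeightOneSpectrum (𝓞 K), (Ideal.absNorm P.asIdeal : ℝ) ^ (-s)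
        + Real.log (s - 1)| ≤ C := by
  set ρ := dedekindZeta_residue K
  have hρ : 0 < ρ := dedekindZeta_residue_pos K
  have hre : Tendsto (fun s : ℝ => (s - 1) * (dedekindZeta K s).re) (𝓝[>] 1) (𝓝 ρ) := by
    have := (Complex.continuous_re.tendsto _).comp (tendsto_sub_one_mul_dedekindZeta_nhdsGT K)
    refine this.congr fun s => ?_
    simp only [Function.comp_apply]
    rw [← Complex.ofReal_one, ← Complex.ofReal_sub, Complex.re_ofReal_mul]
  have hlog : Tendsto (fun s : ℝ => Real.log ((s - 1) * (dedekindZeta K s).re)) (𝓝[>] 1)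
      (𝓝 (Real.log ρ)) := hre.log hρ.ne'
  have hev1 : ∀ᶠ s : ℝ in 𝓝[>] 1, 1 < s ∧ s < 2 ∧ 0 < (s - 1) * (dedekindZeta K s).re ∧
      |Real.log ((s - 1) * (dedekindZeta K s).re) - Real.log ρ| < 1 := by
    have h2 : ∀ᶠ s : ℝ in 𝓝[>] 1, s < 2 :=
      nhdsWithin_le_nhds (Iio_mem_nhds (by norm_num : (1 : ℝ) < 2))
    filter_upwards [self_mem_nhdsWithin, h2, hre.eventually (lt_mem_nhds hρ),
      hlog.eventually (Metric.ball_mem_nhds _ one_pos)] with s a b c d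
    exact ⟨a, b, c, by simpa [Real.dist_eq] using d⟩
  have hpos {s : ℝ} (h1 : 1 < s) (h : 0 < (s - 1) * (dedekindZeta K s).re) :
      0 < (dedekindZeta K s).re := pos_of_mul_pos_right h (by linarith)
  obtain ⟨t, ht1, ht2, htp, -⟩ := hev1.exists
  have hst := (primeSum_bounds K ht1 (hpos ht1 htp)).1
  set M := ∑' P : HeightOneSpectrum (𝓞 K), (Ideal.absNorm P.asIdeal : ℝ) ^ (-t)
  refine ⟨|Real.log ρ| + 1 + 2 * M, hev1.mono fun s ⟨h1, h2, h3, h4⟩ => ?_⟩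
  obtain ⟨b1, b2, b3⟩ := primeSum_bounds K h1 (hpos h1 h3)
  refine ⟨b1, ?_⟩
  have hM : ∑' P : HeightOneSpectrum (𝓞 K), ((Ideal.absNorm P.asIdeal : ℝ) ^ (-s)) ^ 2 ≤ M := by
    have hle (P : HeightOneSpectrum (𝓞 K)) : ((Ideal.absNorm P.asIdeal : ℝ) ^ (-s)) ^ 2 ≤
        (Ideal.absNorm P.asIdeal : ℝ) ^ (-t) := by
      have h2 : (2 : ℝ) ≤ Ideal.absNorm P.asIdeal := by exact_mod_cast two_le_absNorm K P
      rw [← Real.rpow_natCast, ← Real.rpow_mul (by positivity)]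
      exact Real.rpow_le_rpow_of_exponent_le (by linarith) (by push_cast; linarith)
    exact (hst.of_nonneg_of_le (fun _ => sq_nonneg _) hle).tsum_le_tsum hle hst
  rw [Real.log_mul (by linarith) (hpos h1 h3).ne'] at h4
  have c1 := abs_lt.mp h4
  have c2 := neg_abs_le (Real.log ρ)
  have c3 := le_abs_self (Real.log ρ)
  have hM0 : 0 ≤ M := tsum_nonneg fun _ => by positivity
  rw [abs_le]
  constructor <;> linarith [c1.1, c1.2]

/-- If the degree-one primes of `K` over almost all rational primes are known, then so is the
asymptotic behaviour of the corresponding Dirichlet series. -/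
theorem exists_abs_mul_tsum_indicator_add_log_le (π : HeightOneSpectrum (𝓞 K) → ℕ) (g : ℕ)
    (A B : Set ℕ) (hB : B.Finite) (hfin : ∀ p, (π ⁻¹' {p}).Finite)
    (hcard : ∀ p, (π ⁻¹' {p}).ncard ≤ g)
    (h1 : ∀ p ∈ A, p ∉ B → (π ⁻¹' {p}).ncard = g ∧
      ∀ P, π P = p → Ideal.absNorm P.asIdeal = p)
    (h2 : ∀ p ∉ A, p ∉ B → ∀ P, π P = p → p ^ 2 ≤ Ideal.absNorm P.asIdeal)
    (h3 : ∀ P, π P ≠ 0) :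
    ∃ C : ℝ, ∀ᶠ s : ℝ in 𝓝[>] 1,
      |g * ∑' p : ℕ, A.indicator (fun p : ℕ => (p : ℝ) ^ (-s)) p + Real.log (s - 1)| ≤ C := by
  classical
  obtain ⟨C, hC⟩ := exists_abs_tsum_absNorm_rpow_add_log_le K
  set F : ℕ → ℝ := fun p => g * ((p : ℝ) ^ (-2 : ℝ) + B.indicator (fun _ => 1) p) with hF
  have hFs : Summable F := by
    refine Summable.mul_left _ (Summable.add ?_ ?_)
    · exact Real.summable_nat_rpow.mpr (by norm_num)
    · exact summable_of_hasFiniteSupport (hB.subset (by simp))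
  refine ⟨C + ∑' p, F p, ?_⟩
  filter_upwards [hC, self_mem_nhdsWithin] with s ⟨hs, hsC⟩ hs1
  have hs1 : 1 < s := hs1
  have hfib := hs.hasSum.tsum_fiberwise π
  set h : ℕ → ℝ := fun p => ∑' P : π ⁻¹' {p}, (Ideal.absNorm P.1.asIdeal : ℝ) ^ (-s)
  have hA : Summable (A.indicator (fun p : ℕ => (p : ℝ) ^ (-s))) :=
    (Real.summable_nat_rpow.mpr (by linarith)).indicator A
  have hconst (p : ℕ) (c : ℝ) : ∑' _ : π ⁻¹' {p}, c = (π ⁻¹' {p}).ncard * c := by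
    rw [_root_.tsum_const, nsmul_eq_mul, Nat.card_coe_set_eq]
  have hle (p : ℕ) (c : ℝ) (hc0 : 0 ≤ c)
      (hc : ∀ P, π P = p → (Ideal.absNorm P.asIdeal : ℝ) ^ (-s) ≤ c) : h p ≤ g * c := by
    have := (hfin p).to_subtype
    calc h p ≤ ∑' _ : π ⁻¹' {p}, c :=
          (Summable.of_finite).tsum_le_tsum (fun P => hc P.1 P.2) Summable.of_finite
      _ = (π ⁻¹' {p}).ncard * c := hconst p c
      _ ≤ g * c := by gcongr; exact hcard p
  have h0 (p : ℕ) : 0 ≤ h p := tsum_nonneg fun _ => by positivity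
  have key (p : ℕ) : |h p - g * A.indicator (fun p : ℕ => (p : ℝ) ^ (-s)) p| ≤ F p := by
    have hp2 : (0 : ℝ) ≤ (p : ℝ) ^ (-2 : ℝ) := by positivity
    by_cases hpB : p ∈ B
    · have e1 : h p ≤ g * 1 := hle p 1 zero_le_one fun P hP => by
        refine Real.rpow_le_one_of_one_le_of_nonpos ?_ (by linarith)
        have : Ideal.absNorm P.asIdeal ≠ 0 := by
          rw [Ne, Ideal.absNorm_eq_zero_iff]; exact P.ne_bot
        exact_mod_cast Nat.one_le_iff_ne_zero.mpr this
      have e2 : g * A.indicator (fun p : ℕ => (p : ℝ) ^ (-s)) p ≤ g * 1 := by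
        gcongr
        by_cases hpA : p ∈ A
        · rw [Set.indicator_of_mem hpA]
          rcases Nat.eq_zero_or_pos p with rfl | hp
          · simp [Real.zero_rpow (by linarith : -s ≠ 0)]
          · exact Real.rpow_le_one_of_one_le_of_nonpos (by exact_mod_cast hp) (by linarith)
        · rw [Set.indicator_of_notMem hpA]; exact zero_le_one
      have e3 : 0 ≤ g * A.indicator (fun p : ℕ => (p : ℝ) ^ (-s)) p :=
        mul_nonneg (by positivity) (Set.indicator_nonneg (fun _ _ => by positivity) _)
      have e4 : (0 : ℝ) ≤ g * (p : ℝ) ^ (-2 : ℝ) := by positivity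
      simp only [hF, Set.indicator_of_mem hpB, mul_add]
      rw [abs_le]
      constructor <;> linarith [h0 p]
    · simp only [hF, Set.indicator_of_notMem hpB, add_zero]
      by_cases hpA : p ∈ A
      · obtain ⟨c1, c2⟩ := h1 p hpA hpB
        have : h p = g * (p : ℝ) ^ (-s) := by
          rw [← c1, ← hconst]
          exact tsum_congr fun P => by rw [c2 P.1 P.2]
        rw [this, Set.indicator_of_mem hpA, sub_self, abs_zero]
        positivity
      · rw [Set.indicator_of_notMem hpA, mul_zero, sub_zero, abs_of_nonneg (h0 p)]
        refine hle p _ hp2 fun P hP => ?_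
        have hp0 : 0 < p := Nat.pos_of_ne_zero (hP ▸ h3 P)
        have hp1 : (1 : ℝ) ≤ p := by exact_mod_cast hp0
        have := h2 p hpA hpB P hP
        calc (Ideal.absNorm P.asIdeal : ℝ) ^ (-s) ≤ ((p : ℝ) ^ 2) ^ (-s) :=
              Real.rpow_le_rpow_of_nonpos (by positivity) (by exact_mod_cast this) (by linarith)
          _ = (p : ℝ) ^ (2 * (-s)) := by
              rw [Real.rpow_mul (by positivity)]; norm_num
          _ ≤ (p : ℝ) ^ (-2 : ℝ) := Real.rpow_le_rpow_of_exponent_le hp1 (by linarith)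
  have hdiff : Summable fun p => h p - g * A.indicator (fun p : ℕ => (p : ℝ) ^ (-s)) p :=
    hfib.summable.sub (hA.mul_left _)
  have hbound : |∑' p, (h p - g * A.indicator (fun p : ℕ => (p : ℝ) ^ (-s)) p)| ≤ ∑' p, F p :=
    tsum_of_norm_bounded (f := fun p => h p - g * A.indicator (fun p : ℕ => (p : ℝ) ^ (-s)) p)
      hFs.hasSum key
  rw [hfib.summable.tsum_sub (hA.mul_left _), hfib.tsum_eq, tsum_mul_left] at hbound
  rw [abs_le] at hbound hsC ⊢
  constructor <;> linarith [hbound.1, hbound.2, hsC.1, hsC.2]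

end EulerProduct

section SplitPrimes

open NumberField IsDedekindDomain

lemma eq_of_pow_eq_of_sub_mem {R : Type*} [CommRing R] [IsDomain R] (P : Ideal R) [P.IsPrime]
    {x y c : R} {m : ℕ} (hx : x ^ m = c) (hy : y ^ m = c) (hm : (m : R) ∉ P) (hc : c ∉ P)
    (hxy : x - y ∈ P) : x = y := by
  by_contra hne
  have h0 : ∑ i ∈ Finset.range m, x ^ i * y ^ (m - 1 - i) = 0 := by
    have := (Commute.all x y).geom_sum₂_mul m
    rw [hx, hy, sub_self] at this
    exact (mul_eq_zero.mp this).resolve_right (sub_ne_zero.mpr hne)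
  have h1 := congrArg (Ideal.Quotient.mk P) h0
  simp only [map_sum, map_mul, map_pow, (Ideal.Quotient.eq).mpr hxy, map_zero] at h1
  rw [geom_sum₂_self, ← map_natCast (Ideal.Quotient.mk P), mul_eq_zero,
    Ideal.Quotient.eq_zero_iff_mem, ← map_pow, Ideal.Quotient.eq_zero_iff_mem] at h1
  refine h1.elim hm fun h => hc ?_
  rw [← hy]
  have hm0 : m ≠ 0 := by rintro rfl; simp at hm
  exact Ideal.pow_mem_of_mem P (Ideal.IsPrime.mem_of_pow_mem ‹_› _ h) m (Nat.pos_of_ne_zero hm0)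

variable {K : Type*} [Field K]

/-- The rational prime below a height one prime of a number field. -/
noncomputable def primeBelow (P : HeightOneSpectrum (𝓞 K)) : ℕ :=
  Ideal.absNorm (Ideal.under ℤ P.asIdeal)

lemma primeBelow_prime (P : HeightOneSpectrum (𝓞 K)) : (primeBelow P).Prime := by
  have := P.isPrime
  have : NeZero P.asIdeal := ⟨P.ne_bot⟩
  exact Nat.absNorm_under_prime P.asIdeal

instance liesOver_primeBelow (P : HeightOneSpectrum (𝓞 K)) :
    P.asIdeal.LiesOver (Ideal.span {(primeBelow P : ℤ)}) :=
  Int.liesOver_span_absNorm P.asIdeal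

lemma natCast_mem_iff_primeBelow_dvd (P : HeightOneSpectrum (𝓞 K)) (a : ℕ) :
    (a : 𝓞 K) ∈ P.asIdeal ↔ primeBelow P ∣ a := by
  have := Int.cast_mem_ideal_iff (I := P.asIdeal) (d := a)
  simpa [Int.natCast_dvd_natCast, primeBelow] using this

variable [NumberField K]

lemma gal_eq_one_of_sub_mem {ζ β : 𝓞 K} {n d : ℕ} (hζ : ζ ^ n = 1) (hβ : β ^ d = 2)
    (hd : d ∣ n)
    (hK : ∀ σ : Gal(K/ℚ), σ • ζ = ζ → σ • β = β → σ = 1) (P : Ideal (𝓞 K)) [P.IsPrime]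
    (hP : ((2 * n : ℕ) : 𝓞 K) ∉ P) {σ : Gal(K/ℚ)} (h1 : σ • ζ - ζ ∈ P) (h2 : σ • β - β ∈ P) :
    σ = 1 := by
  have hn : (n : 𝓞 K) ∉ P := fun h => hP (by push_cast; exact P.mul_mem_left _ h)
  have h2' : (2 : 𝓞 K) ∉ P := fun h => hP (by push_cast; exact P.mul_mem_right _ h)
  have hd' : (d : 𝓞 K) ∉ P := fun h => hn (by
    obtain ⟨e, rfl⟩ := hd
    push_cast; exact P.mul_mem_right _ h)
  refine hK σ (eq_of_pow_eq_of_sub_mem P (m := n) (c := 1) ?_ hζ hn ?_ h1)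
    (eq_of_pow_eq_of_sub_mem P (m := d) (c := 2) ?_ hβ hd' h2' h2)
  · rw [← smul_pow', hζ, smul_one]
  · exact (Ideal.ne_top_iff_one P).mp (Ideal.IsPrime.ne_top ‹_›)
  · rw [← smul_pow', hβ]
    exact map_ofNat (MulSemiringAction.toRingHom Gal(K/ℚ) (𝓞 K) σ) 2

lemma image_primeBelow_fiber {p : ℕ} (hp : p.Prime) :
    HeightOneSpectrum.asIdeal '' (primeBelow (K := K) ⁻¹' {p}) =
      (Ideal.span {(p : ℤ)}).primesOver (𝓞 K) := by
  ext P
  constructor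
  · rintro ⟨P, rfl, rfl⟩
    exact ⟨P.isPrime, inferInstance⟩
  · rintro ⟨hP, hPp⟩
    have hmem : (p : 𝓞 K) ∈ P := by
      have := (Ideal.mem_of_liesOver P (Ideal.span {(p : ℤ)}) p).mp
        (Ideal.mem_span_singleton_self _)
      simpa using this
    have hP0 : P ≠ ⊥ := by
      rintro rfl
      simp [hp.ne_zero] at hmem
    refine ⟨⟨P, hP, hP0⟩, ?_, rfl⟩
    exact (Nat.prime_dvd_prime_iff_eq (primeBelow_prime _) hp).mp
      ((natCast_mem_iff_primeBelow_dvd _ _).mp hmem)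

lemma ncard_primeBelow_fiber {p : ℕ} (hp : p.Prime) :
    (primeBelow (K := K) ⁻¹' {p}).ncard = ((Ideal.span {(p : ℤ)}).primesOver (𝓞 K)).ncard := by
  rw [← image_primeBelow_fiber hp, Set.ncard_image_of_injective]
  exact fun P Q h => HeightOneSpectrum.ext h

lemma finite_primeBelow_fiber (p : ℕ) : (primeBelow (K := K) ⁻¹' {p}).Finite := by
  by_cases hp : p.Prime
  · refine Set.Finite.of_finite_image (f := HeightOneSpectrum.asIdeal) ?_
      (fun P _ Q _ h => HeightOneSpectrum.ext h)
    rw [image_primeBelow_fiber hp]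
    have : Fact p.Prime := ⟨hp⟩
    have := Int.ideal_span_isMaximal_of_prime p
    exact IsDedekindDomain.primesOver_finite _ _
  · convert Set.finite_empty
    ext P
    simp only [Set.mem_preimage, Set.mem_singleton_iff, Set.mem_empty_iff_false, iff_false]
    rintro rfl
    exact hp (primeBelow_prime P)

lemma ncard_primeBelow_fiber_mul [IsGalois ℚ K] (P : HeightOneSpectrum (𝓞 K)) :
    (primeBelow (K := K) ⁻¹' {primeBelow P}).ncard * Nat.card (P.asIdeal.inertia Gal(K/ℚ)) *
      (Ideal.span {(primeBelow P : ℤ)}).inertiaDeg' P.asIdeal = Module.finrank ℚ K := by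
  have hp := primeBelow_prime P
  have : Fact (primeBelow P).Prime := ⟨hp⟩
  have := Int.ideal_span_isMaximal_of_prime (primeBelow P)
  have := P.isPrime
  have := P.isMaximal
  rw [ncard_primeBelow_fiber hp, Ideal.inertiaDeg'_eq_inertiaDeg,
    Ideal.ncard_primesOver_mul_card_inertia_mul_finrank, IsGalois.card_aut_eq_finrank]

lemma ncard_primeBelow_fiber_le [IsGalois ℚ K] (p : ℕ) :
    (primeBelow (K := K) ⁻¹' {p}).ncard ≤ Module.finrank ℚ K := by
  rcases (primeBelow (K := K) ⁻¹' {p}).eq_empty_or_nonempty with h | ⟨P, rfl⟩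
  · simp [h]
  · refine Nat.le_of_dvd Module.finrank_pos ?_
    rw [← ncard_primeBelow_fiber_mul P, mul_assoc]
    exact dvd_mul_right _ _

lemma absNorm_eq_primeBelow_pow (P : HeightOneSpectrum (𝓞 K)) :
    Ideal.absNorm P.asIdeal =
      primeBelow P ^ (Ideal.span {(primeBelow P : ℤ)}).inertiaDeg' P.asIdeal :=
  Ideal.absNorm_eq_pow_inertiaDeg' P.asIdeal (primeBelow_prime P)

/-- The primes `p` such that `p ≡ 1 (mod n)` and `2` is a `d`-th power modulo `p`. -/
def splitPrimes (n d : ℕ) : Set ℕ :=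
  {p | p.Prime ∧ n ∣ p - 1 ∧ ∃ x : ZMod p, x ^ d = 2}

lemma pow_primeBelow_sub_mem [IsGalois ℚ K] {ζ β : 𝓞 K} {n d : ℕ} (hζ : ζ ^ n = 1)
    (hβ : β ^ d = 2) (hd : d ∣ n)
    (hK : ∀ σ : Gal(K/ℚ), σ • ζ = ζ → σ • β = β → σ = 1) (P : HeightOneSpectrum (𝓞 K))
    (hA : primeBelow P ∈ splitPrimes n d) (hB : ¬ primeBelow P ∣ 2 * n) (x : 𝓞 K) :
    x ^ primeBelow P - x ∈ P.asIdeal := by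
  have := P.isPrime
  obtain ⟨hp, ⟨e, he⟩, z, hz⟩ := hA
  set p := primeBelow P with hpdef
  have : Fact p.Prime := ⟨hp⟩
  obtain ⟨σ, hσ⟩ := IsArithFrobAt.exists_of_isInvariant ℤ Gal(K/ℚ) P.asIdeal
  have hσ' (x : 𝓞 K) : σ • x - x ^ p ∈ P.asIdeal := by
    have := hσ x
    rwa [← Submodule.cardQuot_apply, ← Ideal.absNorm_apply] at this
  have hpe : p = n * e + 1 := by have := hp.one_lt; omega
  have hσ1 : σ = 1 := by
    refine gal_eq_one_of_sub_mem hζ hβ hd hK P.asIdeal ?_ ?_ ?_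
    · rwa [natCast_mem_iff_primeBelow_dvd]
    · have := hσ' ζ
      rwa [hpe, pow_succ, pow_mul, hζ, one_pow, one_mul] at this
    · obtain ⟨f, rfl⟩ := hd
      have h2 : (2 : ZMod p) ^ (f * e) = 1 := by
        rw [← hz, ← pow_mul, ← mul_assoc, ← he]
        refine ZMod.pow_card_sub_one_eq_one ?_
        rintro rfl
        have hd0 : d ≠ 0 := by rintro rfl; simp at hB
        rw [zero_pow hd0] at hz
        apply hB
        rw [← Nat.cast_ofNat, eq_comm, ZMod.natCast_eq_zero_iff] at hz
        exact hz.mul_right _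
      have h3 : (2 : 𝓞 K) ^ (f * e) - 1 ∈ P.asIdeal := by
        have : ((2 ^ (f * e) - 1 : ℕ) : 𝓞 K) ∈ P.asIdeal := by
          rw [natCast_mem_iff_primeBelow_dvd, ← hpdef, ← ZMod.natCast_eq_zero_iff,
            Nat.cast_sub Nat.one_le_two_pow]
          simp [h2]
        rwa [Nat.cast_sub Nat.one_le_two_pow, Nat.cast_pow, Nat.cast_ofNat, Nat.cast_one] at this
      have h4 := hσ' β
      rw [hpe, pow_succ, mul_assoc, pow_mul, hβ] at h4
      have := P.asIdeal.add_mem h4 (P.asIdeal.mul_mem_right β h3)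
      convert this using 1
      ring
  have := hσ' x
  rw [hσ1, one_smul] at this
  rw [← neg_sub]
  exact P.asIdeal.neg_mem this

lemma inertiaDeg'_eq_one_of_pow_sub_mem (P : HeightOneSpectrum (𝓞 K))
    (h : ∀ x : 𝓞 K, x ^ primeBelow P - x ∈ P.asIdeal) :
    (Ideal.span {(primeBelow P : ℤ)}).inertiaDeg' P.asIdeal = 1 := by
  have hp := primeBelow_prime P
  have := P.isMaximal
  let := Ideal.Quotient.field P.asIdeal
  have hfin : Finite (𝓞 K ⧸ P.asIdeal) := inferInstance
  let := Fintype.ofFinite (𝓞 K ⧸ P.asIdeal)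
  have hle : Nat.card (𝓞 K ⧸ P.asIdeal) ≤ primeBelow P := by
    classical
    have hne : (Polynomial.X ^ primeBelow P - Polynomial.X : Polynomial (𝓞 K ⧸ P.asIdeal)) ≠ 0 :=
      FiniteField.X_pow_card_sub_X_ne_zero _ hp.one_lt
    have hsub : (Finset.univ : Finset (𝓞 K ⧸ P.asIdeal)) ⊆
        (Polynomial.X ^ primeBelow P - Polynomial.X :
          Polynomial (𝓞 K ⧸ P.asIdeal)).roots.toFinset := by
      intro y _
      obtain ⟨y, rfl⟩ := Ideal.Quotient.mk_surjective y
      rw [Multiset.mem_toFinset, Polynomial.mem_roots hne]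
      simpa [Polynomial.IsRoot, sub_eq_zero] using Ideal.Quotient.eq_zero_iff_mem.mpr (h y)
    calc Nat.card (𝓞 K ⧸ P.asIdeal) = (Finset.univ : Finset (𝓞 K ⧸ P.asIdeal)).card := by simp
      _ ≤ _ := Finset.card_le_card hsub
      _ ≤ _ := Multiset.toFinset_card_le _
      _ ≤ _ := Polynomial.card_roots' _
      _ = _ := FiniteField.X_pow_card_sub_X_natDegree_eq _ hp.one_lt
  have h1 := absNorm_eq_primeBelow_pow P
  rw [Ideal.absNorm_apply, Submodule.cardQuot_apply] at h1
  rw [h1] at hle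
  have h2 : 1 < Nat.card (𝓞 K ⧸ P.asIdeal) := Finite.one_lt_card
  rw [h1] at h2
  set f := (Ideal.span {(primeBelow P : ℤ)}).inertiaDeg' P.asIdeal
  have : f ≤ 1 := by
    by_contra hf
    have := Nat.pow_lt_pow_right hp.one_lt (not_le.mp hf)
    rw [pow_one] at this
    omega
  have : f ≠ 0 := fun h0 => by simp [h0] at h2
  omega

lemma ncard_primeBelow_fiber_eq [IsGalois ℚ K] {ζ β : 𝓞 K} {n d : ℕ} (hζ : ζ ^ n = 1)
    (hβ : β ^ d = 2) (hd : d ∣ n)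
    (hK : ∀ σ : Gal(K/ℚ), σ • ζ = ζ → σ • β = β → σ = 1) (P : HeightOneSpectrum (𝓞 K))
    (hA : primeBelow P ∈ splitPrimes n d) (hB : ¬ primeBelow P ∣ 2 * n) :
    (primeBelow (K := K) ⁻¹' {primeBelow P}).ncard = Module.finrank ℚ K := by
  have := P.isPrime
  have hI : P.asIdeal.inertia Gal(K/ℚ) = ⊥ := by
    rw [eq_bot_iff]
    intro σ hσ
    exact gal_eq_one_of_sub_mem hζ hβ hd hK P.asIdeal
      (by rwa [natCast_mem_iff_primeBelow_dvd]) (hσ ζ) (hσ β)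
  rw [← ncard_primeBelow_fiber_mul P, hI,
    inertiaDeg'_eq_one_of_pow_sub_mem P (pow_primeBelow_sub_mem hζ hβ hd hK P hA hB)]
  simp

lemma exists_liesOver_primeBelow {p : ℕ} (hp : p.Prime) :
    ∃ P : HeightOneSpectrum (𝓞 K), primeBelow P = p := by
  have : Fact p.Prime := ⟨hp⟩
  have := Int.ideal_span_isMaximal_of_prime p
  obtain ⟨⟨P, hP⟩⟩ := (Ideal.span {(p : ℤ)}).nonempty_primesOver (S := 𝓞 K)
  rw [← image_primeBelow_fiber hp] at hP
  obtain ⟨Q, hQ, -⟩ := hP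
  exact ⟨Q, hQ⟩

lemma sq_primeBelow_le_absNorm {ζ β : 𝓞 K} {n d : ℕ} (hζ : IsPrimitiveRoot ζ n)
    (hβ : β ^ d = 2) (P : HeightOneSpectrum (𝓞 K))
    (hA : primeBelow P ∉ splitPrimes n d) (hB : ¬ primeBelow P ∣ 2 * n) :
    primeBelow P ^ 2 ≤ Ideal.absNorm P.asIdeal := by
  have hp := primeBelow_prime P
  have := P.isPrime
  have := P.isMaximal
  by_contra! hlt
  have h1 := absNorm_eq_primeBelow_pow P
  rw [h1, Nat.pow_lt_pow_iff_right hp.one_lt] at hlt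
  have hN1 : Ideal.absNorm P.asIdeal ≠ 1 := by
    rw [Ne, Ideal.absNorm_eq_one_iff]
    exact P.isPrime.ne_top
  have hf : (Ideal.span {(primeBelow P : ℤ)}).inertiaDeg' P.asIdeal = 1 := by
    rcases Nat.eq_zero_or_pos ((Ideal.span {(primeBelow P : ℤ)}).inertiaDeg' P.asIdeal) with h | h
    · rw [h, pow_zero] at h1
      exact absurd h1 hN1
    · omega
  rw [hf, pow_one] at h1
  have : Fact (primeBelow P).Prime := ⟨hp⟩
  let := Ideal.Quotient.field P.asIdeal
  let := Fintype.ofFinite (𝓞 K ⧸ P.asIdeal)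
  rw [Ideal.absNorm_apply, Submodule.cardQuot_apply, Nat.card_eq_fintype_card] at h1
  let e := ZMod.ringEquivOfPrime (𝓞 K ⧸ P.asIdeal) hp h1
  refine hA ⟨hp, ?_, e.symm (Ideal.Quotient.mk _ β), ?_⟩
  · rw [← hζ.pow_eq_one_iff_dvd]
    refine eq_of_pow_eq_of_sub_mem P.asIdeal (m := n) (c := 1) ?_ (one_pow _) ?_ ?_ ?_
    · rw [← pow_mul, mul_comm, pow_mul, hζ.pow_eq_one, one_pow]
    · rw [natCast_mem_iff_primeBelow_dvd]
      exact fun h => hB (h.mul_left _)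
    · exact (Ideal.ne_top_iff_one _).mp P.isPrime.ne_top
    · rw [← Ideal.Quotient.eq, map_pow, map_one, ← h1]
      refine FiniteField.pow_card_sub_one_eq_one _ fun h0 => ?_
      have hn0 : n ≠ 0 := by rintro rfl; simp at hB
      have := congrArg (Ideal.Quotient.mk P.asIdeal) hζ.pow_eq_one
      rw [map_pow, h0, zero_pow hn0, map_one] at this
      exact zero_ne_one this
  · rw [← map_pow, ← map_pow, hβ]
    exact (congrArg e.symm (map_ofNat (Ideal.Quotient.mk P.asIdeal) 2)).trans (map_ofNat e.symm 2)

lemma exists_abs_finrank_mul_tsum_splitPrimes_add_log_le [IsGalois ℚ K] {ζ β : 𝓞 K} {n d : ℕ}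
    (hn : n ≠ 0) (hζ : IsPrimitiveRoot ζ n) (hβ : β ^ d = 2) (hd : d ∣ n)
    (hK : ∀ σ : Gal(K/ℚ), σ • ζ = ζ → σ • β = β → σ = 1) :
    ∃ C : ℝ, ∀ᶠ s : ℝ in nhdsWithin 1 (Set.Ioi 1),
      |Module.finrank ℚ K * ∑' p : ℕ, (splitPrimes n d).indicator (fun p : ℕ => (p : ℝ) ^ (-s)) p
        + Real.log (s - 1)| ≤ C := by
  refine exists_abs_mul_tsum_indicator_add_log_le K primeBelow _ _ {p | p ∣ 2 * n} ?_
    finite_primeBelow_fiber ncard_primeBelow_fiber_le ?_ ?_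
    fun P => (primeBelow_prime P).ne_zero
  · exact (Nat.divisors (2 * n)).finite_toSet.subset fun p hp => by
      simpa [hn] using hp
  · intro p hA hB
    obtain ⟨P, rfl⟩ := exists_liesOver_primeBelow (K := K) hA.1
    refine ⟨ncard_primeBelow_fiber_eq hζ.pow_eq_one hβ hd hK P hA hB, fun Q hQ => ?_⟩
    rw [absNorm_eq_primeBelow_pow, inertiaDeg'_eq_one_of_pow_sub_mem Q, pow_one, hQ]
    rw [← hQ] at hA hB
    exact pow_primeBelow_sub_mem hζ.pow_eq_one hβ hd hK Q hA hB
  · rintro p hA hB P rfl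
    exact sq_primeBelow_le_absNorm hζ hβ P hA hB

end SplitPrimes

section Kummer

open Polynomial NumberField

lemma Rat.pow_ne_two {m : ℕ} (hm : 2 ≤ m) (b : ℚ) : b ^ m ≠ 2 := by
  intro h
  have h2 := congrArg (padicValRat 2) h
  rw [padicValRat.pow, show (2 : ℚ) = ((2 : ℕ) : ℚ) by norm_num, padicValRat.self one_lt_two] at h2
  have h3 : (m : ℤ) ∣ 1 := ⟨_, h2.symm⟩
  have := Int.le_of_dvd one_pos h3
  omega

lemma natDegree_minpoly_eq_of_pow_eq_two {F L : Type*} [Field F] [Field L] [Algebra F L] {q : ℕ}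
    (hq : q.Prime) (hF : ∀ b : F, b ^ q ≠ 2) {γ : L} (hγ : γ ^ q = 2) :
    minpoly F γ = X ^ q - C 2 := by
  refine (minpoly.eq_of_irreducible_of_monic (X_pow_sub_C_irreducible_of_prime hq hF) ?_
    (monic_X_pow_sub_C 2 hq.ne_zero)).symm
  simp [hγ, map_ofNat (algebraMap F L) 2]

lemma pow_ne_two_of_isCyclotomicExtension_of_odd {n q : ℕ} [NeZero n] {F : Type*} [Field F]
    [CharZero F] [IsCyclotomicExtension {n} ℚ F] (hq : q.Prime) (hq2 : q ≠ 2) (δ : F) :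
    δ ^ q ≠ 2 := by
  intro hδ
  have := IsCyclotomicExtension.isAbelianGalois {n} ℚ F
  have : FiniteDimensional ℚ F := IsCyclotomicExtension.finiteDimensional {n} ℚ F
  have : Fact q.Prime := ⟨hq⟩
  let E := IntermediateField.adjoin ℚ {δ}
  have hfin : Module.finrank ℚ E = q := by
    rw [IntermediateField.adjoin.finrank (IsIntegral.of_finite ℚ δ),
      natDegree_minpoly_eq_of_pow_eq_two hq (Rat.pow_ne_two hq.two_le) hδ, natDegree_X_pow_sub_C]
  let ε : E := IntermediateField.AdjoinSimple.gen ℚ δ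
  have hε : ε ^ q = 2 := Subtype.ext hδ
  have := instIsAbelianGaloisSubtypeMemIntermediateField ℚ F E
  have hN : Normal ℚ E := by
    convert this.toIsGalois.to_normal
    exact Subsingleton.elim _ _
  have hmin := natDegree_minpoly_eq_of_pow_eq_two hq (Rat.pow_ne_two hq.two_le) hε
  have hirr := X_pow_sub_C_irreducible_of_prime hq (Rat.pow_ne_two hq.two_le)
  have hsplit := hN.splits ε
  rw [hmin] at hsplit
  have hcard := card_rootSet_eq_natDegree hirr.separable hsplit
  rw [natDegree_X_pow_sub_C] at hcard
  have : Nontrivial ((X ^ q - C 2 : ℚ[X]).rootSet E) :=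
    Fintype.one_lt_card_iff_nontrivial.mp (by rw [hcard]; exact hq.one_lt)
  have hεmem : ε ∈ (X ^ q - C 2 : ℚ[X]).rootSet E := by
    rw [mem_rootSet_of_ne hirr.ne_zero]
    simp [hε]
  obtain ⟨⟨ε', hε'⟩, hne⟩ := exists_ne (⟨ε, hεmem⟩ : (X ^ q - C 2 : ℚ[X]).rootSet E)
  have hne : ε' ≠ ε := fun h => hne (Subtype.ext h)
  rw [mem_rootSet_of_ne hirr.ne_zero] at hε'
  have hε' : ε' ^ q = 2 := by simpa [sub_eq_zero] using hε'
  have hε0 : ε ≠ 0 := by rintro h; rw [h, zero_pow hq.ne_zero] at hε; exact two_ne_zero hε.symm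
  have hη : IsPrimitiveRoot (ε' / ε) q := by
    rw [IsPrimitiveRoot.iff_orderOf]
    refine orderOf_eq_prime ?_ ?_
    · rw [div_pow, hε, hε', div_self two_ne_zero]
    · rwa [Ne, div_eq_one_iff_eq hε0]
  have hdvd := minpoly.degree_dvd (IsIntegral.of_finite ℚ (ε' / ε))
  rw [← cyclotomic_eq_minpoly_rat hη hq.pos, natDegree_cyclotomic, Nat.totient_prime hq,
    hfin] at hdvd
  have h1 : q - 1 ∣ 1 := by
    have := Nat.dvd_sub hdvd (dvd_refl (q - 1))
    rwa [Nat.sub_sub_self hq.one_le] at this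
  have := Nat.le_of_dvd one_pos h1
  have := hq.two_le
  omega

lemma sq_ne_two_of_isCyclotomicExtension {n : ℕ} [NeZero n] {F : Type*} [Field F]
    [CharZero F] [IsCyclotomicExtension {n} ℚ F] (h4 : 4 ∣ n) (h8 : ¬ 8 ∣ n) (δ : F) :
    δ ^ 2 ≠ 2 := by
  intro hδ
  have : FiniteDimensional ℚ F := IsCyclotomicExtension.finiteDimensional {n} ℚ F
  have hζ := IsCyclotomicExtension.zeta_spec n ℚ F
  have hn := NeZero.pos n
  obtain ⟨m, rfl⟩ := h4
  have hm : Odd m := by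
    rw [← Nat.not_even_iff_odd, even_iff_two_dvd]
    rintro ⟨k, rfl⟩
    exact h8 ⟨k, by ring⟩
  have hi := hζ.pow hn (mul_comm 4 m)
  set i := IsCyclotomicExtension.zeta (4 * m) ℚ F ^ m
  have hi2 : i ^ 2 = -1 :=
    (hi.pow (by norm_num) (show 4 = 2 * 2 by norm_num)).eq_neg_one_of_two_right
  have hδ0 : δ ≠ 0 := by rintro rfl; norm_num at hδ
  have hω2 : ((1 + i) / δ) ^ 2 = i := by
    rw [div_pow, hδ, div_eq_iff two_ne_zero]
    linear_combination hi2
  have hω : IsPrimitiveRoot ((1 + i) / δ) (2 ^ (2 + 1)) := by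
    rw [IsPrimitiveRoot.iff_orderOf]
    refine orderOf_eq_prime_pow ?_ ?_
    · rw [show 2 ^ 2 = 2 * 2 by norm_num, pow_mul, hω2, hi2]
      norm_num
    · rw [show 2 ^ (2 + 1) = 2 * (2 * 2) by norm_num, pow_mul, hω2, pow_mul, hi2]
      norm_num
  have hlcm : (4 * m).lcm (2 ^ (2 + 1)) = 8 * m := by
    rw [show 2 ^ (2 + 1) = 4 * 2 by norm_num, Nat.lcm_mul_left,
      Nat.Coprime.lcm_eq_mul (Nat.coprime_two_right.mpr hm)]
    ring
  have hle := hζ.lcm_totient_le_finrank hω (cyclotomic.irreducible_rat (by rw [hlcm]; omega))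
  rw [hlcm, IsCyclotomicExtension.finrank F (cyclotomic.irreducible_rat hn),
    Nat.totient_mul (Nat.Coprime.pow_left 3 (Nat.coprime_two_left.mpr hm) : (2 ^ 3).Coprime m),
    Nat.totient_mul (Nat.Coprime.pow_left 2 (Nat.coprime_two_left.mpr hm) : (2 ^ 2).Coprime m),
    show Nat.totient 8 = 4 by decide, show Nat.totient 4 = 2 by decide] at hle
  have : 0 < m.totient := Nat.totient_pos.mpr hm.pos
  omega

lemma pow_ne_two_of_isCyclotomicExtension {n q : ℕ} [NeZero n] {F : Type*} [Field F]
    [CharZero F] [IsCyclotomicExtension {n} ℚ F] (h4 : 4 ∣ n) (h8 : ¬ 8 ∣ n) (hq : q.Prime)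
    (δ : F) : δ ^ q ≠ 2 := by
  by_cases h : q = 2
  · subst h
    exact sq_ne_two_of_isCyclotomicExtension h4 h8 δ
  · exact pow_ne_two_of_isCyclotomicExtension_of_odd (n := n) hq h δ

lemma finrank_eq_totient_mul {n d : ℕ} (h4 : 4 ∣ n) (h8 : ¬ 8 ∣ n)
    (hdsq : Squarefree d) {K : Type*} [Field K] [NumberField K] {ζ β : K}
    (hζ : IsPrimitiveRoot ζ n) (hβ : β ^ d = 2)
    (htop : IntermediateField.adjoin ℚ {ζ, β} = ⊤) :
    Module.finrank ℚ K = n.totient * d := by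
  have hn : n ≠ 0 := by rintro rfl; simp at h8
  have : NeZero n := ⟨hn⟩
  have hd0 : 0 < d := hdsq.ne_zero.bot_lt
  set F := IntermediateField.adjoin ℚ {ζ} with hFdef
  have := hζ.intermediateField_adjoin_isCyclotomicExtension ℚ
  have hcyc : IsCyclotomicExtension {n} ℚ F := by
    convert this
    · rfl
    · exact Subsingleton.elim _ _
  have hF : Module.finrank ℚ F = n.totient := by
    rw [IntermediateField.adjoin.finrank (IsIntegral.of_finite ℚ ζ),
      ← cyclotomic_eq_minpoly_rat hζ hn.bot_lt, natDegree_cyclotomic]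
  have hKtop : IntermediateField.adjoin F {β} = ⊤ := by
    rw [← IntermediateField.restrictScalars_eq_top_iff (K := ℚ), ← htop]
    exact IntermediateField.adjoin_simple_adjoin_simple ℚ ζ β
  rw [← Module.finrank_mul_finrank ℚ F K, hF]
  congr 1
  apply le_antisymm
  · rw [← IntermediateField.finrank_top', ← hKtop,
      IntermediateField.adjoin.finrank (IsIntegral.of_finite F β),
      ← natDegree_X_pow_sub_C (n := d) (r := (2 : F))]
    refine natDegree_le_of_dvd (minpoly.dvd F β ?_) (monic_X_pow_sub_C 2 hd0.ne').ne_zero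
    simp [hβ, map_ofNat (algebraMap F K) 2]
  · refine Nat.le_of_dvd Module.finrank_pos ?_
    rw [← Nat.prod_primeFactors_of_squarefree hdsq]
    refine Finset.prod_primes_dvd _ (fun q hq => (Nat.prime_of_mem_primeFactors hq).prime)
      fun q hq => ?_
    have hq' := Nat.prime_of_mem_primeFactors hq
    have hγ : (β ^ (d / q)) ^ q = 2 := by
      rw [← pow_mul, Nat.div_mul_cancel (Nat.dvd_of_mem_primeFactors hq), hβ]
    have := minpoly.degree_dvd (IsIntegral.of_finite F (β ^ (d / q)))
    rwa [natDegree_minpoly_eq_of_pow_eq_two hq'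
      (pow_ne_two_of_isCyclotomicExtension (n := n) h4 h8 hq') hγ, natDegree_X_pow_sub_C] at this

lemma exists_adjoin_pair_eq_top {n d : ℕ} (hn : n ≠ 0) (hd : d ∣ n) (K : Type*) [Field K]
    [CharZero K] [IsSplittingField ℚ K ((X ^ n - C 1) * (X ^ d - C 2))] :
    ∃ ζ β : K, IsPrimitiveRoot ζ n ∧ β ^ d = 2 ∧ IntermediateField.adjoin ℚ {ζ, β} = ⊤ := by
  have hd0 : d ≠ 0 := ne_zero_of_dvd_ne_zero hn hd
  have : NeZero n := ⟨hn⟩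
  set f : ℚ[X] := (X ^ n - C 1) * (X ^ d - C 2) with hf
  have hf1 : (X ^ n - C 1 : ℚ[X]) ≠ 0 := (monic_X_pow_sub_C 1 hn).ne_zero
  have hf2 : (X ^ d - C 2 : ℚ[X]) ≠ 0 := (monic_X_pow_sub_C 2 hd0).ne_zero
  have hf0 : f ≠ 0 := mul_ne_zero hf1 hf2
  have hsplit : (f.map (algebraMap ℚ K)).Splits := IsSplittingField.splits K f
  have hs1 : ((cyclotomic n ℚ).map (algebraMap ℚ K)).Splits := by
    refine hsplit.of_dvd (Polynomial.map_ne_zero hf0)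
      (Polynomial.map_dvd (algebraMap ℚ K) (Dvd.dvd.mul_right ?_ _))
    rw [C_1]
    exact cyclotomic.dvd_X_pow_sub_one n ℚ
  have hs2 : ((X ^ d - C 2 : ℚ[X]).map (algebraMap ℚ K)).Splits :=
    hsplit.of_dvd (Polynomial.map_ne_zero hf0)
      (Polynomial.map_dvd (algebraMap ℚ K) (dvd_mul_left _ _))
  obtain ⟨ζ, hζ⟩ := hs1.exists_eval_eq_zero (by
    rw [degree_map, degree_cyclotomic]; exact_mod_cast (Nat.totient_pos.mpr hn.bot_lt).ne')
  obtain ⟨β, hβ⟩ := hs2.exists_eval_eq_zero (by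
    rw [degree_map, degree_X_pow_sub_C hd0.bot_lt]; exact_mod_cast hd0)
  rw [map_cyclotomic] at hζ
  have hζ : IsPrimitiveRoot ζ n := isRoot_cyclotomic_iff.mp hζ
  have hβ : β ^ d = 2 := by simpa [sub_eq_zero] using hβ
  refine ⟨ζ, β, hζ, hβ, ?_⟩
  rw [eq_top_iff, ← IntermediateField.toSubalgebra_le_toSubalgebra,
    IntermediateField.top_toSubalgebra, ← IsSplittingField.adjoin_rootSet K f]
  refine Algebra.adjoin_le fun x hx => ?_
  have hζm : ζ ∈ IntermediateField.adjoin ℚ {ζ, β} := IntermediateField.subset_adjoin _ _ (by simp)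
  have hβm : β ∈ IntermediateField.adjoin ℚ {ζ, β} := IntermediateField.subset_adjoin _ _ (by simp)
  have hroot (y : K) (hy : y ^ n = 1) : y ∈ IntermediateField.adjoin ℚ {ζ, β} := by
    obtain ⟨i, -, rfl⟩ := hζ.eq_pow_of_pow_eq_one hy
    exact pow_mem hζm i
  rw [mem_rootSet_of_ne hf0, hf, map_mul, mul_eq_zero] at hx
  have hx' : x ^ n = 1 ∨ x ^ d = 2 := by simpa [sub_eq_zero, map_ofNat (algebraMap ℚ K) 2] using hx
  rcases hx' with hx' | hx'
  · exact hroot x hx'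
  · have hβ0 : β ≠ 0 := by rintro rfl; rw [zero_pow hd0] at hβ; exact two_ne_zero hβ.symm
    rw [← div_mul_cancel₀ x hβ0]
    refine mul_mem (hroot _ ?_) hβm
    obtain ⟨e, rfl⟩ := hd
    rw [pow_mul, div_pow, hx', hβ, div_self two_ne_zero, one_pow]

/-- The field generated by the `n`-th roots of unity and the `d`-th roots of `2`. -/
lemma exists_kummer_field {n d : ℕ} (hn : n ≠ 0) (hd : d ∣ n) :
    ∃ (K : Type) (_ : Field K) (_ : NumberField K) (_ : IsGalois ℚ K) (ζ β : K),
      IsPrimitiveRoot ζ n ∧ β ^ d = 2 ∧ IntermediateField.adjoin ℚ {ζ, β} = ⊤ := by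
  set f : ℚ[X] := (X ^ n - C 1) * (X ^ d - C 2) with hf
  have hchar : CharZero f.SplittingField := algebraRat.charZero _
  have hsf : IsSplittingField ℚ f.SplittingField f := by
    convert IsSplittingField.splittingField f
    exact Subsingleton.elim _ _
  have hfd := IsSplittingField.finiteDimensional f.SplittingField f
  have hN : Normal ℚ f.SplittingField := Normal.of_isSplittingField f
  exact ⟨f.SplittingField, inferInstance, { to_charZero := hchar, to_finiteDimensional := hfd },
    {}, exists_adjoin_pair_eq_top hn hd _⟩

lemma gal_eq_one_of_smul_eq {K : Type*} [Field K] [NumberField K] {ζ β : 𝓞 K}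
    (htop : IntermediateField.adjoin ℚ {(ζ : K), (β : K)} = ⊤) {σ : Gal(K/ℚ)}
    (h1 : σ • ζ = ζ) (h2 : σ • β = β) : σ = 1 := by
  have h1' : σ (ζ : K) = ζ := congrArg (algebraMap (𝓞 K) K) h1
  have h2' : σ (β : K) = β := congrArg (algebraMap (𝓞 K) K) h2
  ext x
  have hx : x ∈ IntermediateField.adjoin ℚ {(ζ : K), (β : K)} := htop ▸ IntermediateField.mem_top
  induction hx using IntermediateField.adjoin_induction with
  | mem x hx =>
    rcases hx with rfl | rfl
    · exact h1'
    · exact h2'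
  | algebraMap x => simp
  | add x y _ _ hx hy => simpa using congrArg₂ (· + ·) hx hy
  | inv x _ hx => simpa using congrArg (·⁻¹) hx
  | mul x y _ _ hx hy => simpa using congrArg₂ (· * ·) hx hy

lemma exists_abs_totient_mul_tsum_splitPrimes_add_log_le {n d : ℕ} (h4 : 4 ∣ n) (h8 : ¬ 8 ∣ n)
    (hd : d ∣ n) (hdsq : Squarefree d) :
    ∃ C : ℝ, ∀ᶠ s : ℝ in nhdsWithin 1 (Set.Ioi 1),
      |(n.totient * d : ℕ) *
        ∑' p : ℕ, (splitPrimes n d).indicator (fun p : ℕ => (p : ℝ) ^ (-s)) p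
        + Real.log (s - 1)| ≤ C := by
  have hn : n ≠ 0 := by rintro rfl; simp at h8
  obtain ⟨K, _, _, _, ζ, β, hζ, hβ, htop⟩ := exists_kummer_field hn hd
  rw [← finrank_eq_totient_mul h4 h8 hdsq hζ hβ htop]
  obtain ⟨ζ, rfl⟩ : ∃ z : 𝓞 K, (z : K) = ζ := ⟨⟨ζ, hζ.isIntegral hn.bot_lt⟩, rfl⟩
  obtain ⟨β, rfl⟩ : ∃ z : 𝓞 K, (z : K) = β := by
    refine ⟨⟨β, IsIntegral.of_pow (ne_zero_of_dvd_ne_zero hn hd).bot_lt ?_⟩, rfl⟩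
    rw [hβ, ← map_ofNat (algebraMap ℤ K) 2]
    exact isIntegral_algebraMap
  refine exists_abs_finrank_mul_tsum_splitPrimes_add_log_le hn
    (hζ.of_map_of_injective (f := algebraMap (𝓞 K) K) RingOfIntegers.coe_injective) ?_ hd
    fun σ => gal_eq_one_of_smul_eq htop
  apply RingOfIntegers.coe_injective
  rw [map_pow, hβ, map_ofNat]

end Kummer

section Density

open Filter Topology

lemma exists_pow_mul_eq_of_coprime {F : Type*} [Field F] {a b : ℕ} (hab : a.Coprime b) {c x y : F}
    (hc : c ≠ 0) (hx : x ^ a = c) (hy : y ^ b = c) : ∃ z, z ^ (a * b) = c := by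
  by_cases ha : a = 0
  · subst ha
    exact ⟨1, by simpa using hx⟩
  by_cases hb : b = 0
  · subst hb
    exact ⟨1, by simpa using hy⟩
  have hx0 : x ≠ 0 := by rintro rfl; exact hc (by rw [← hx, zero_pow ha])
  have hy0 : y ≠ 0 := by rintro rfl; exact hc (by rw [← hy, zero_pow hb])
  refine ⟨x ^ a.gcdB b * y ^ a.gcdA b, ?_⟩
  have hbez : (a : ℤ) * a.gcdA b + b * a.gcdB b = 1 := by
    rw [← Nat.gcd_eq_gcd_ab, hab, Nat.cast_one]
  rw [mul_pow, ← zpow_natCast, ← zpow_natCast, ← zpow_mul, ← zpow_mul,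
    show a.gcdB b * ((a * b : ℕ) : ℤ) = a * (b * a.gcdB b) by push_cast; ring,
    show a.gcdA b * ((a * b : ℕ) : ℤ) = b * (a * a.gcdA b) by push_cast; ring,
    zpow_mul x, zpow_mul y, zpow_natCast, zpow_natCast, hx, hy, ← zpow_add₀ hc, add_comm, hbez,
    zpow_one]

lemma exists_pow_prod_eq_iff {F : Type*} [Field F] {c : F} (hc : c ≠ 0) {T : Finset ℕ}
    (hT : ∀ q ∈ T, q.Prime) :
    (∃ x, x ^ (∏ q ∈ T, q) = c) ↔ ∀ q ∈ T, ∃ x, x ^ q = c := by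
  refine ⟨fun ⟨x, hx⟩ q hq => ?_, fun h => ?_⟩
  · obtain ⟨e, he⟩ := Finset.dvd_prod_of_mem (fun q => q) hq
    exact ⟨x ^ e, by rw [← pow_mul, mul_comm, ← he, hx]⟩
  · induction T using Finset.induction_on with
    | empty => exact ⟨c, by simp⟩
    | insert q T hq ih =>
      obtain ⟨x, hx⟩ := h q (Finset.mem_insert_self q T)
      obtain ⟨y, hy⟩ := ih (fun r hr => hT r (Finset.mem_insert_of_mem hr))
        fun r hr => h r (Finset.mem_insert_of_mem hr)
      rw [Finset.prod_insert hq]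
      refine exists_pow_mul_eq_of_coprime (Nat.Coprime.prod_right fun r hr => ?_) hc hx hy
      refine (Nat.coprime_primes (hT q (Finset.mem_insert_self q T))
        (hT r (Finset.mem_insert_of_mem hr))).mpr ?_
      rintro rfl
      exact hq hr

lemma sum_powerset_indicator_splitPrimes_eq_zero {n : ℕ} (h4 : 4 ∣ n)
    (h : ∀ p : ℕ, p.Prime → n ∣ p - 1 → ∃ q ∈ n.primeFactors, ∃ x : ZMod p, x ^ q = 2)
    (f : ℕ → ℝ) (p : ℕ) :
    ∑ T ∈ n.primeFactors.powerset, (-1) ^ T.card * (splitPrimes n (∏ q ∈ T, q)).indicator f p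
      = 0 := by
  classical
  by_cases hp : p.Prime ∧ n ∣ p - 1
  · have : Fact p.Prime := ⟨hp.1⟩
    have h2 : (2 : ZMod p) ≠ 0 := by
      intro h0
      rw [← Nat.cast_ofNat, ZMod.natCast_eq_zero_iff, Nat.prime_dvd_prime_iff_eq hp.1 Nat.prime_two]
        at h0
      have := hp.2
      rw [h0] at this
      exact absurd (h4.trans this) (by norm_num)
    have hT (T) (hT : T ∈ n.primeFactors.powerset) :
        (-1) ^ T.card * (splitPrimes n (∏ q ∈ T, q)).indicator f p =
          (∏ q ∈ T, -(if ∃ x : ZMod p, x ^ q = 2 then 1 else 0)) * f p := by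
      rw [Finset.mem_powerset] at hT
      have hmem : p ∈ splitPrimes n (∏ q ∈ T, q) ↔ ∀ q ∈ T, ∃ x : ZMod p, x ^ q = 2 := by
        rw [← exists_pow_prod_eq_iff h2 fun q hq => Nat.prime_of_mem_primeFactors (hT hq)]
        exact ⟨fun h => h.2.2, fun h => ⟨hp.1, hp.2, h⟩⟩
      rw [Finset.prod_neg, mul_assoc, Finset.prod_boole, Set.indicator_apply, hmem]
      simp
    rw [Finset.sum_congr rfl hT, ← Finset.sum_mul, ← Finset.prod_one_add]
    obtain ⟨q, hq, hx⟩ := h p hp.1 hp.2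
    rw [Finset.prod_eq_zero hq (by simp [hx]), zero_mul]
  · refine Finset.sum_eq_zero fun T _ => ?_
    rw [Set.indicator_of_notMem, mul_zero]
    exact fun h => hp ⟨h.1, h.2.1⟩

theorem exists_prime_forall_pow_ne_two {n : ℕ} (h4 : 4 ∣ n) (h8 : ¬ 8 ∣ n) :
    ∃ p : ℕ, p.Prime ∧ n ∣ p - 1 ∧ ∀ q ∈ n.primeFactors, ∀ x : ZMod p, x ^ q ≠ 2 := by
  by_contra! hcon
  have hn : n ≠ 0 := by rintro rfl; simp at h8
  set D : Finset ℕ → ℕ := fun T => ∏ q ∈ T, q with hD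
  have hprime {T} (hT : T ∈ n.primeFactors.powerset) (q) (hq : q ∈ T) : q.Prime :=
    Nat.prime_of_mem_primeFactors (Finset.mem_powerset.mp hT hq)
  have hDdvd {T} (hT : T ∈ n.primeFactors.powerset) : D T ∣ n :=
    Finset.prod_primes_dvd _ (fun q hq => (hprime hT q hq).prime)
      fun q hq => Nat.dvd_of_mem_primeFactors (Finset.mem_powerset.mp hT hq)
  have hDsq {T} (hT : T ∈ n.primeFactors.powerset) : Squarefree (D T) := by
    refine Finset.squarefree_prod_of_pairwise_isCoprime ?_
      fun q hq => (hprime hT q hq).prime.squarefree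
    intro q hq r hr hqr
    exact Nat.coprime_iff_isRelPrime.mp
      ((Nat.coprime_primes (hprime hT q hq) (hprime hT r hr)).mpr hqr)
  have hS (T) : ∃ C : ℝ, T ∈ n.primeFactors.powerset → ∀ᶠ s : ℝ in 𝓝[>] 1,
      |∑' p : ℕ, (splitPrimes n (D T)).indicator (fun p : ℕ => (p : ℝ) ^ (-s)) p
        + Real.log (s - 1) / (n.totient * D T)| ≤ C := by
    by_cases hT : T ∈ n.primeFactors.powerset
    · obtain ⟨C, hC⟩ :=
        exists_abs_totient_mul_tsum_splitPrimes_add_log_le h4 h8 (hDdvd hT) (hDsq hT)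
      have hpos : (0 : ℝ) < n.totient * D T := by
        exact_mod_cast Nat.mul_pos (Nat.totient_pos.mpr (Nat.pos_of_ne_zero hn))
          (Nat.pos_of_ne_zero (hDsq hT).ne_zero)
      refine ⟨C / (n.totient * D T), fun _ => hC.mono fun s hs => ?_⟩
      rw [le_div_iff₀ hpos, ← abs_of_pos hpos, ← abs_mul, abs_of_pos hpos, add_mul,
        div_mul_cancel₀ _ hpos.ne', mul_comm]
      exact_mod_cast hs
    · exact ⟨0, fun h => absurd h hT⟩
  choose C hC using hS
  set c : ℝ := ∑ T ∈ n.primeFactors.powerset, (-1) ^ T.card / (n.totient * D T) with hc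
  have hcpos : 0 < c := by
    have : c = (∏ q ∈ n.primeFactors, (1 + -(q : ℝ)⁻¹)) / n.totient := by
      rw [Finset.prod_one_add, Finset.sum_div, hc]
      refine Finset.sum_congr rfl fun T _ => ?_
      rw [Finset.prod_neg, Finset.prod_inv_distrib, hD]
      push_cast
      ring
    rw [this]
    refine div_pos (Finset.prod_pos fun q hq => ?_)
      (by exact_mod_cast Nat.totient_pos.mpr hn.bot_lt)
    have : (q : ℝ)⁻¹ < 1 := inv_lt_one_of_one_lt₀
      (by exact_mod_cast (Nat.prime_of_mem_primeFactors hq).one_lt)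
    linarith
  have hbound : ∀ᶠ s : ℝ in 𝓝[>] 1,
      c * |Real.log (s - 1)| ≤ ∑ T ∈ n.primeFactors.powerset, C T := by
    have hall := (Finset.eventually_all n.primeFactors.powerset).mpr fun T hT => hC T hT
    filter_upwards [hall, self_mem_nhdsWithin] with s hs hs1
    have hs1 : 1 < s := hs1
    have hsum (T) : Summable ((splitPrimes n (D T)).indicator (fun p : ℕ => (p : ℝ) ^ (-s))) :=
      (Real.summable_nat_rpow.mpr (by linarith)).indicator _
    have h0 : ∑ T ∈ n.primeFactors.powerset, (-1) ^ T.card *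
        ∑' p : ℕ, (splitPrimes n (D T)).indicator (fun p : ℕ => (p : ℝ) ^ (-s)) p = 0 := by
      simp_rw [← tsum_mul_left]
      rw [← Summable.tsum_finsetSum fun T _ => (hsum T).mul_left _]
      simp_rw [hD, sum_powerset_indicator_splitPrimes_eq_zero h4 hcon, tsum_zero]
    have h1 : c * Real.log (s - 1) = ∑ T ∈ n.primeFactors.powerset, (-1) ^ T.card *
        (∑' p : ℕ, (splitPrimes n (D T)).indicator (fun p : ℕ => (p : ℝ) ^ (-s)) p
          + Real.log (s - 1) / (n.totient * D T)) := by
      simp_rw [mul_add]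
      rw [Finset.sum_add_distrib, h0, zero_add, hc, Finset.sum_mul]
      exact Finset.sum_congr rfl fun T _ => by ring
    rw [← abs_of_pos hcpos, ← abs_mul, h1]
    refine (Finset.abs_sum_le_sum_abs _ _).trans (Finset.sum_le_sum fun T hT => ?_)
    rw [abs_mul, abs_pow, abs_neg, abs_one, one_pow, one_mul]
    exact hs T hT
  have hlog : Tendsto (fun s : ℝ => c * |Real.log (s - 1)|) (𝓝[>] 1) atTop := by
    refine Tendsto.const_mul_atTop hcpos (tendsto_abs_atBot_atTop.comp
      (Real.tendsto_log_nhdsGT_zero.comp ?_))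
    refine tendsto_nhdsWithin_iff.mpr ⟨?_, ?_⟩
    · have : Tendsto (fun s : ℝ => s - 1) (𝓝 1) (𝓝 (1 - 1)) := tendsto_id.sub_const 1
      rw [sub_self] at this
      exact this.mono_left nhdsWithin_le_nhds
    · filter_upwards [self_mem_nhdsWithin] with s hs
      exact sub_pos.mpr (show (1 : ℝ) < s from hs)
  obtain ⟨s, hs1, hs2⟩ := (hbound.and (hlog.eventually_gt_atTop _)).exists
  exact absurd hs1 (not_le.mpr hs2)

end Density

lemma Subgroup.index_dvd_of_pow_mem {G : Type*} [Group G] [Finite G] {g : G}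
    (hg : orderOf g = Nat.card G) (H : Subgroup G) {i : ℕ} (hi : g ^ i ∈ H) : H.index ∣ i := by
  have h1 : g ^ (i * Nat.card H) = 1 := by
    rw [pow_mul]
    exact congrArg Subtype.val (pow_card_eq_one' (x := (⟨g ^ i, hi⟩ : H)))
  have h2 := orderOf_dvd_of_pow_eq_one h1
  rw [hg, ← H.index_mul_card] at h2
  exact Nat.dvd_of_mul_dvd_mul_right Nat.card_pos h2

lemma exists_prime_pow_eq_of_mem_of_ne_top {G : Type*} [Group G] [Finite G] [IsCyclic G]
    {H : Subgroup G} (hH : H ≠ ⊤) {n k : ℕ} (hcard : Nat.card G = n * k)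
    (hk : ∀ x : G, x ^ k = 1 → x ∈ H) {u : G} (hu : u ∈ H) :
    ∃ q : ℕ, q.Prime ∧ q ∣ n ∧ ∃ x, x ^ q = u := by
  obtain ⟨g, hg⟩ := IsCyclic.exists_ofOrder_eq_natCard (α := G)
  obtain ⟨q, hq, hqH⟩ := Nat.exists_prime_and_dvd (mt Subgroup.index_eq_one.mp hH)
  refine ⟨q, hq, hqH.trans (H.index_dvd_of_pow_mem hg (hk _ ?_)), ?_⟩
  · rw [← pow_mul, ← hcard, pow_card_eq_one']
  · have hgen : u ∈ Submonoid.powers g := by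
      rw [mem_powers_iff_mem_zpowers,
        (Subgroup.eq_top_of_card_eq (Subgroup.zpowers g) (by rw [Nat.card_zpowers, hg]))]
      trivial
    obtain ⟨i, rfl⟩ := hgen
    obtain ⟨j, hj⟩ := hqH.trans (H.index_dvd_of_pow_mem hg hu)
    exact ⟨g ^ j, by simp only [← pow_mul, hj, mul_comm]⟩

lemma closure_insert_two_ne_top {n k : ℕ} (h8 : 8 ∣ n) (hk : 0 < k) (hp : (n * k + 1).Prime)
    {u : (ZMod (n * k + 1))ˣ} (hu : (u : ZMod (n * k + 1)) = 2) :
    Subgroup.closure (insert u {x : (ZMod (n * k + 1))ˣ | x ^ k = 1}) ≠ ⊤ := by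
  intro htop
  have : Fact (n * k + 1).Prime := ⟨hp⟩
  obtain ⟨m, rfl⟩ := h8
  have hm : 0 < m := Nat.pos_of_ne_zero (by rintro rfl; simp [Nat.not_prime_one] at hp)
  have hu1 : u ^ (4 * m * k) = 1 := by
    have hmod : (8 * m * k + 1) % 8 = 1 := by rw [mul_assoc]; omega
    obtain ⟨y, hy⟩ := (ZMod.exists_sq_eq_two_iff (p := 8 * m * k + 1) (by
      intro h; omega)).mpr (Or.inl hmod)
    have hy0 : y ≠ 0 := by
      rintro rfl
      exact u.ne_zero (by rw [hu, hy, mul_zero])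
    ext
    rw [Units.val_pow_eq_pow_val, hu, hy, ← sq, ← pow_mul, Units.val_one]
    convert ZMod.pow_card_sub_one_eq_one hy0 using 2
    rw [Nat.add_sub_cancel]
    ring
  have hle : Subgroup.closure (insert u {x : (ZMod (8 * m * k + 1))ˣ | x ^ k = 1}) ≤
      (powMonoidHom (4 * m * k)).ker := by
    rw [Subgroup.closure_le]
    rintro x (rfl | hx)
    · exact hu1
    · rw [SetLike.mem_coe, MonoidHom.mem_ker, powMonoidHom_apply, pow_mul',
        show x ^ k = 1 from hx, one_pow]
  obtain ⟨g, hg⟩ := IsCyclic.exists_ofOrder_eq_natCard (α := (ZMod (8 * m * k + 1))ˣ)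
  rw [htop] at hle
  have hdvd := orderOf_dvd_of_pow_eq_one (show g ^ (4 * m * k) = 1 from hle trivial)
  rw [hg, Nat.card_eq_fintype_card, ZMod.card_units, Nat.add_sub_cancel] at hdvd
  have hpos := Nat.mul_pos hm hk
  have := Nat.le_of_dvd (by rw [mul_assoc]; omega) hdvd
  rw [mul_assoc, mul_assoc] at this
  omega

theorem stmt_3 (n : ℕ) (hn : 0 < n) :
    (∃ k : ℕ, 0 < k ∧ Nat.Prime (n * k + 1) ∧
      ∃ u : (ZMod (n * k + 1))ˣ, ((u : ZMod (n * k + 1)) = 2) ∧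
        Subgroup.closure (insert u {x : (ZMod (n * k + 1))ˣ | x ^ k = 1}) = ⊤)
    ↔ ¬ (8 ∣ n) := by
  refine ⟨fun ⟨k, hk, hp, u, hu, htop⟩ h8 => closure_insert_two_ne_top h8 hk hp hu htop,
    fun h8 => ?_⟩
  have h8' : ¬ 8 ∣ n.lcm 4 := by
    intro h
    have h4 : 8 ∣ n * 4 := h.trans (Nat.lcm_dvd_mul n 4)
    have h2 : 8 ∣ n * 2 := h.trans (Nat.lcm_dvd (Nat.dvd_mul_right n 2) (by omega))
    exact h8 (h.trans (Nat.lcm_dvd dvd_rfl (by omega)))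
  obtain ⟨p, hp, hdvd, hpow⟩ := exists_prime_forall_pow_ne_two (Nat.dvd_lcm_right n 4) h8'
  obtain ⟨k, hk⟩ := (Nat.dvd_lcm_left n 4).trans hdvd
  obtain rfl : p = n * k + 1 := by have := hp.pos; omega
  have : Fact (n * k + 1).Prime := ⟨hp⟩
  have hk0 : 0 < k := Nat.pos_of_ne_zero (by rintro rfl; simp [Nat.not_prime_one] at hp)
  have h2 : (2 : ZMod (n * k + 1)) ≠ 0 := fun h =>
    hpow 2 (Nat.mem_primeFactors.mpr ⟨Nat.prime_two, (by norm_num : 2 ∣ 4).trans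
      (Nat.dvd_lcm_right n 4), Nat.lcm_ne_zero hn.ne' (by norm_num)⟩) 0 (by rw [h]; simp)
  refine ⟨k, hk0, hp, Units.mk0 2 h2, rfl, ?_⟩
  by_contra htop
  obtain ⟨q, hq, hqn, x, hx⟩ := exists_prime_pow_eq_of_mem_of_ne_top htop (n := n) (k := k)
    (by rw [Nat.card_eq_fintype_card, ZMod.card_units, Nat.add_sub_cancel])
    (fun x hx => Subgroup.subset_closure (Set.mem_insert_of_mem _ hx))
    (Subgroup.subset_closure (Set.mem_insert _ _))
  refine hpow q (Nat.mem_primeFactors.mpr ⟨hq, hqn.trans (Nat.dvd_lcm_left n 4),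
    Nat.lcm_ne_zero hn.ne' (by norm_num)⟩) x ?_
  rw [← Units.val_pow_eq_pow_val, hx, Units.val_mk0]
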